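/- Let (R,m) be an F-finite regular local ring of dimension d and prime characteristic p > 0. Then for every integer n ≥ 1: τ(m^n) = R if n < d, and τ(m^n) = m^{n-d+1} if n ≥ d. -/

import Mathlib

open scoped TensorProduct

universe u

variable (R : Type u) [CommRing R]

/-- `R°`: the set of elements of `R` not contained in any minimal prime ideal. -/
def Rcirc : Set R := {c : R | ∀ P ∈ minimalPrimes R, c ∉ P}

/-- The Frobenius power `I^{[q]}`: the ideal generated by the `q`-th powers of elements of `I`. -/
def frobPow (I : Ideal R) (q : ℕ) : Ideal R := Ideal.span ((fun x : R => x ^ q) '' (I : Set R))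

/-- The `a^t`-tight closure of an ideal `J`. -/
def tightClosure (p : ℕ) (a : Ideal R) (t : ℚ) (J : Ideal R) : Set R :=
  {z : R | ∃ c ∈ Rcirc R, ∃ e₀ : ℕ, ∀ e : ℕ, e₀ ≤ e →
    ∀ x ∈ a ^ ⌈t * (p : ℚ) ^ e⌉₊, c * z ^ p ^ e * x ∈ frobPow R J (p ^ e)}

/-- The generalized test ideal `τ(a^t) = ⋂_J (J : J^{*aᵗ})`. -/
def testIdeal (p : ℕ) (a : Ideal R) (t : ℚ) : Ideal R :=
  ⨅ J : Ideal R, Submodule.colon J (Ideal.span (tightClosure R p a t J))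

/-- `R` is F-finite: finitely generated over itself via the Frobenius endomorphism. -/
def FrobAlg (p e : ℕ) : Type u := R

instance : CommRing (FrobAlg R p e) := inferInstanceAs (CommRing R)

/-- The identity of `R`, viewed as a ring map `R →+* ᵉR`. -/
def FrobAlg.of (p e : ℕ) : R →+* FrobAlg R p e := RingHom.id R

noncomputable instance [ExpChar R p] : Algebra R (FrobAlg R p e) :=
  ((FrobAlg.of R p e).comp (iterateFrobenius R p e)).toAlgebra

/-- F-finiteness of `R`. -/
def IsFFinite (p : ℕ) [ExpChar R p] : Prop := Module.Finite R (FrobAlg R p 1)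

/-- `0^{*aᵗ}_M`, the `aᵗ`-tight closure of zero in a module `M`. -/
def moduleTC (p : ℕ) [ExpChar R p] (a : Ideal R) (t : ℚ)
    (M : Type u) [AddCommGroup M] [Module R M] : Set M :=
  {z : M | ∃ c ∈ Rcirc R, ∃ e₀ : ℕ, ∀ e : ℕ, e₀ ≤ e →
    ∀ x ∈ a ^ ⌈t * (p : ℚ) ^ e⌉₊,
      (FrobAlg.of R p e (c * x)) ⊗ₜ[R] z = (0 : TensorProduct R (FrobAlg R p e) M)}

/-- `τ̃(aᵗ) = Ann_R (0^{*aᵗ}_E)`. -/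
def tildeTau (p : ℕ) [ExpChar R p] (a : Ideal R) (t : ℚ)
    (E : Type u) [AddCommGroup E] [Module R E] : Ideal R :=
  (Submodule.span R (moduleTC R p a t E)).annihilator

/-- `E` is an injective hull of the `R`-module `M`. -/
def IsInjectiveHull (M : Type u) [AddCommGroup M] [Module R M]
    (E : Type u) [AddCommGroup E] [Module R E] : Prop :=
  Module.Injective R E ∧
    ∃ ι : M →ₗ[R] E, Function.Injective ι ∧
      ∀ N : Submodule R E, N ≠ ⊥ → N ⊓ LinearMap.range ι ≠ ⊥

/-- `d` is an `aᵗ`-test element. -/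
def IsTestElement (p : ℕ) [ExpChar R p] (a : Ideal R) (t : ℚ) (d : R) : Prop :=
  d ∈ Rcirc R ∧
    ∀ (M : Type u) [AddCommGroup M] [Module R M], Module.Finite R M →
      ∀ z : M, z ∈ moduleTC R p a t M ↔
        ∀ e : ℕ, ∀ x ∈ a ^ ⌈t * (p : ℚ) ^ e⌉₊,
          (FrobAlg.of R p e (d * x)) ⊗ₜ[R] z = (0 : TensorProduct R (FrobAlg R p e) M)


/-- `(R,m)` is a regular local ring: Noetherian local and the maximal ideal is generated by
`dim R` elements. -/
def IsRegularLocal [IsLocalRing R] : Prop :=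
  IsNoetherianRing R ∧
    ∃ (d : ℕ) (x : Fin d → R),
      Ideal.span (Set.range x) = IsLocalRing.maximalIdeal R ∧ ringKrullDim R = d

open IsLocalRing in
theorem aux_maxIdeal_quot {A : Type*} [CommRing A] [IsLocalRing A] (I : Ideal A) (_hI : I ≤ maximalIdeal A)
    [IsLocalRing (A ⧸ I)] :
    (maximalIdeal A).map (Ideal.Quotient.mk I) = maximalIdeal (A ⧸ I) := by
  apply le_antisymm
  · rw [Ideal.map_le_iff_le_comap]
    exact le_of_eq ((eq_maximalIdeal (Ideal.comap_isMaximal_of_surjective _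
      Ideal.Quotient.mk_surjective)).symm)
  · intro y hy
    obtain ⟨r, rfl⟩ := Ideal.Quotient.mk_surjective y
    apply Ideal.mem_map_of_mem
    rw [mem_maximalIdeal, mem_nonunits_iff] at hy ⊢
    exact fun h => hy (h.map _)

open IsLocalRing in
theorem aux_quot_local {A : Type*} [CommRing A] [IsLocalRing A] (I : Ideal A) (hI : I ≤ maximalIdeal A) :
    IsLocalRing (A ⧸ I) := by
  have : Nontrivial (A ⧸ I) := Ideal.Quotient.nontrivial_iff.2
    (fun h => (maximalIdeal.isMaximal A).ne_top (top_le_iff.1 (h ▸ hI)))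
  exact IsLocalRing.of_surjective' _ Ideal.Quotient.mk_surjective

open IsLocalRing in
theorem aux_domain (n : ℕ) : ∀ (A : Type u) [CommRing A] [IsLocalRing A] [IsNoetherianRing A]
    (s : Finset A), Ideal.span (s : Set A) = maximalIdeal A → s.card ≤ n →
    (n : WithBot ℕ∞) ≤ ringKrullDim A → IsDomain A := by
  classical
  induction n with
  | zero =>
    intro A _ _ _ s hs hc _
    have : s = ∅ := by simpa using hc
    subst this
    have : IsField A := by
      rw [isField_iff_maximalIdeal_eq, ← hs]; simp
    exact this.isDomain
  | succ n ih =>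
    intro A _ _ _ s hs hc hdim
    have hnotmin : maximalIdeal A ∉ minimalPrimes A := by
      intro h
      rw [← Ideal.height_eq_zero_iff] at h
      rw [← maximalIdeal_height_eq_ringKrullDim, h] at hdim
      norm_cast at hdim
    have hmin : ∀ P ∈ minimalPrimes A, ¬ maximalIdeal A ≤ P := by
      intro P hP h
      have hp : P.IsPrime := hP.1.1
      have : P = maximalIdeal A := le_antisymm (le_maximalIdeal hp.ne_top) h
      exact hnotmin (this ▸ hP)
    have hne : (minimalPrimes A).Nonempty := by
      obtain ⟨P, hP, _⟩ := Ideal.exists_minimalPrimes_le (I := (⊥ : Ideal A)) (J := maximalIdeal A) bot_le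
      exact ⟨P, hP⟩
    obtain ⟨x, hxm, hx2, hxP⟩ : ∃ x ∈ maximalIdeal A, x ∉ maximalIdeal A ^ 2 ∧
        ∀ P ∈ minimalPrimes A, x ∉ P := by
      by_contra hcon
      push Not at hcon
      have hfin := minimalPrimes.finite_of_isNoetherianRing A
      have hsub : ((maximalIdeal A : Ideal A) : Set A) ⊆
          ⋃ i ∈ ((insert (maximalIdeal A ^ 2) hfin.toFinset : Finset (Ideal A)) : Set (Ideal A)),
            ((id i : Ideal A) : Set A) := by
        intro y hy
        by_cases h2 : y ∈ maximalIdeal A ^ 2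
        · exact Set.mem_biUnion (by simp) h2
        · obtain ⟨P, hP, hyP⟩ := hcon y hy h2
          exact Set.mem_biUnion (x := P) (by simp [hP]) hyP
      rw [Ideal.subset_union_prime (maximalIdeal A ^ 2) (maximalIdeal A ^ 2)] at hsub
      · obtain ⟨P, hP, hle⟩ := hsub
        rw [Finset.mem_insert] at hP
        rcases hP with rfl | hP
        · have : maximalIdeal A = ⊥ := by
            apply Submodule.eq_bot_of_le_smul_of_le_jacobson_bot (maximalIdeal A) (maximalIdeal A)
              (IsNoetherian.noetherian _)
            · simpa [pow_two] using hle
            · exact (IsLocalRing.jacobson_eq_maximalIdeal ⊥ bot_ne_top).ge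
          obtain ⟨P, hP⟩ := hne
          exact hmin P hP (this ▸ bot_le)
        · exact hmin P (by simpa using hP) hle
      · intro i hi h _
        rw [Finset.mem_insert] at hi
        rcases hi with rfl | hi
        · exact absurd rfl h
        · have : i ∈ minimalPrimes A := by simpa using hi
          exact this.1.1
    -- replace a generator
    have hxs : x ∈ Ideal.span (s : Set A) := hs ▸ hxm
    obtain ⟨f, -, hf⟩ := Submodule.mem_span_finset.1 hxs
    obtain ⟨a, has, hfa⟩ : ∃ a ∈ s, f a ∉ maximalIdeal A := by
      by_contra hcon
      push Not at hcon
      apply hx2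
      rw [← hf, pow_two]
      refine Ideal.sum_mem _ fun a ha => Ideal.mul_mem_mul (hcon a ha) ?_
      rw [← hs]; exact Ideal.subset_span ha
    have hxI : Ideal.span {x} ≤ maximalIdeal A := by
      rw [Ideal.span_singleton_le_iff_mem]; exact hxm
    have := aux_quot_local _ hxI
    have hdom : IsDomain (A ⧸ Ideal.span {x}) := by
      apply ih _ ((s.erase a).image (Ideal.Quotient.mk (Ideal.span {x})))
      · rw [← aux_maxIdeal_quot _ hxI, Finset.coe_image, ← Ideal.map_span, ← hs]
        apply le_antisymm
        · exact Ideal.map_mono (Ideal.span_mono (by simp))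
        · rw [Ideal.map_span (Ideal.Quotient.mk (Ideal.span {x})) (s : Set A), Ideal.span_le]
          rintro _ ⟨b, hb, rfl⟩
          by_cases hba : b = a
          · subst hba
            have hu : IsUnit (f b) := by simpa using hfa
            obtain ⟨v, hv⟩ := hu.exists_left_inv
            have : Ideal.Quotient.mk (Ideal.span {x}) b =
                Ideal.Quotient.mk (Ideal.span {x}) (- v * ∑ c ∈ s.erase b, f c * c) := by
              rw [Ideal.Quotient.eq, Ideal.mem_span_singleton']
              refine ⟨v, ?_⟩
              rw [← hf, ← Finset.add_sum_erase _ _ hb]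
              simp only [smul_eq_mul]
              linear_combination b * hv
            rw [this]
            apply Ideal.mem_map_of_mem
            apply Ideal.mul_mem_left
            exact Ideal.sum_mem _ fun c hc => Ideal.mul_mem_left _ _ (Ideal.subset_span hc)
          · exact Ideal.mem_map_of_mem _ (Ideal.subset_span (by simpa [hba] using hb))
      · refine Finset.card_image_le.trans ?_
        rw [Finset.card_erase_of_mem has]; omega
      · have h := ringKrullDim_le_ringKrullDim_quotient_add_card ({x} : Finset A)
          (by simpa [ringJacobson_eq_maximalIdeal] using hxm)
        have h2 := hdim.trans h
        rw [Finset.coe_singleton, Finset.card_singleton] at h2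
        push_cast at h2
        exact (ENat.WithBot.add_le_add_one_right_iff).1 h2
    have hprime : (Ideal.span {x}).IsPrime := (Ideal.Quotient.isDomain_iff_prime _).1 hdom
    obtain ⟨P, hP, hPx⟩ := Ideal.exists_minimalPrimes_le (I := (⊥ : Ideal A)) (J := Ideal.span {x}) bot_le
    have hPp : P.IsPrime := hP.1.1
    have : P = ⊥ := by
      apply Submodule.eq_bot_of_le_smul_of_le_jacobson_bot (maximalIdeal A) P
              (IsNoetherian.noetherian _)
      · intro y hy
        obtain ⟨z, rfl⟩ := Ideal.mem_span_singleton'.1 (hPx hy)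
        rw [mul_comm]
        exact Submodule.smul_mem_smul hxm ((hPp.mem_or_mem hy).resolve_right (hxP P hP))
      · exact (IsLocalRing.jacobson_eq_maximalIdeal ⊥ bot_ne_top).ge
    subst this
    exact IsDomain.of_bot_isPrime A

/-- Ideal generated by powers `x j ^ a j`, `j ∈ S`. -/
def QI {A : Type*} [CommRing A] {d : ℕ} (x : Fin d → A) (S : Finset (Fin d)) (a : Fin d → ℕ) : Ideal A :=
  Ideal.span ((fun j => x j ^ a j) '' (S : Set (Fin d)))

open IsLocalRing in
theorem aux_base {A : Type u} [CommRing A] [IsLocalRing A] [IsNoetherianRing A] {d : ℕ}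
    (x : Fin d → A) (hx : Ideal.span (Set.range x) = maximalIdeal A) (hd : ringKrullDim A = d)
    (S : Finset (Fin d)) (i : Fin d) (hi : i ∉ S) (r : A)
    (hr : x i * r ∈ Ideal.span (x '' (S : Set (Fin d)))) :
    r ∈ Ideal.span (x '' (S : Set (Fin d))) := by
  classical
  have hle : Ideal.span (x '' (S : Set (Fin d))) ≤ maximalIdeal A := by
    rw [← hx]; exact Ideal.span_mono (Set.image_subset_range _ _)
  have hxm : ∀ j, x j ∈ maximalIdeal A := fun j => hx ▸ Ideal.subset_span ⟨j, rfl⟩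
  have := aux_quot_local _ hle
  have hdom : IsDomain (A ⧸ Ideal.span (x '' (S : Set (Fin d)))) := by
    apply aux_domain (d - S.card) _ ((Sᶜ).image
      (fun j => Ideal.Quotient.mk (Ideal.span (x '' (S : Set (Fin d)))) (x j)))
    · rw [← aux_maxIdeal_quot _ hle, ← hx]
      apply le_antisymm
      · rw [Ideal.span_le]
        intro y hy
        simp only [Finset.coe_image, Set.mem_image] at hy
        obtain ⟨j, -, rfl⟩ := hy
        exact Ideal.mem_map_of_mem _ (Ideal.subset_span ⟨j, rfl⟩)
      · rw [Ideal.map_span, Ideal.span_le]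
        rintro _ ⟨_, ⟨j, rfl⟩, rfl⟩
        by_cases hj : j ∈ S
        · have : Ideal.Quotient.mk (Ideal.span (x '' (S : Set (Fin d)))) (x j) = 0 :=
            Ideal.Quotient.eq_zero_iff_mem.2 (Ideal.subset_span ⟨j, hj, rfl⟩)
          rw [this]; exact Ideal.zero_mem _
        · apply Ideal.subset_span
          simp only [Finset.coe_image, Set.mem_image]
          exact ⟨j, by simpa using hj, rfl⟩
    · refine Finset.card_image_le.trans ?_
      rw [Finset.card_compl]; simp
    · have h := ringKrullDim_le_ringKrullDim_quotient_add_card (S.image x)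
          (by
            rw [ringJacobson_eq_maximalIdeal]
            intro y hy
            simp only [Finset.coe_image, Set.mem_image] at hy
            obtain ⟨j, -, rfl⟩ := hy
            exact hxm j)
      rw [hd, Finset.coe_image] at h
      have h2 : ((S.image x).card : WithBot ℕ∞) ≤ (S.card : WithBot ℕ∞) := by
        exact_mod_cast Finset.card_image_le
      have h3 := h.trans (add_le_add_right h2 _)
      have h4 : S.card ≤ d := by simpa using Finset.card_le_univ S
      have h5 : (d : WithBot ℕ∞) = ((d - S.card : ℕ) : WithBot ℕ∞) + (S.card : WithBot ℕ∞) := by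
        rw [← Nat.cast_add]; congr 1; omega
      rw [h5] at h3
      exact (ENat.WithBot.add_le_add_natCast_right_iff).1 h3
  have hprime : (Ideal.span (x '' (S : Set (Fin d)))).IsPrime :=
    (Ideal.Quotient.isDomain_iff_prime _).1 hdom
  refine (hprime.mem_or_mem hr).resolve_left fun hmem => ?_
  have hgen : Ideal.span (((Finset.univ.erase i).image x : Finset A) : Set A) = maximalIdeal A := by
    rw [← hx]
    apply le_antisymm
    · apply Ideal.span_mono
      intro y hy
      simp only [Finset.coe_image, Set.mem_image] at hy
      obtain ⟨j, -, rfl⟩ := hy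
      exact ⟨j, rfl⟩
    · rw [Ideal.span_le]
      rintro _ ⟨j, rfl⟩
      by_cases hj : j = i
      · subst hj
        refine Ideal.span_mono ?_ hmem
        rintro _ ⟨k, hk, rfl⟩
        simp only [Finset.coe_image, Set.mem_image]
        refine ⟨k, ?_, rfl⟩
        simp only [Finset.coe_erase, Set.mem_sdiff, Set.mem_singleton_iff]
        exact ⟨by simp, fun h => hi (h ▸ hk)⟩
      · apply Ideal.subset_span
        simp only [Finset.coe_image, Set.mem_image]
        exact ⟨j, by simpa using hj, rfl⟩
  have h1 := ringKrullDim_le_spanFinrank_maximalIdeal A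
  rw [hd] at h1
  have h2 := Submodule.spanFinrank_span_le_ncard_of_finite (R := A)
    (Finset.finite_toSet ((Finset.univ.erase i).image x))
  have h3 : (maximalIdeal A).spanFinrank ≤ (Set.ncard (((Finset.univ.erase i).image x : Finset A) : Set A)) := by
    rw [← hgen]; exact h2
  rw [Set.ncard_coe_finset] at h3
  have h4 : ((Finset.univ.erase i).image x).card ≤ (Finset.univ.erase i).card := Finset.card_image_le
  rw [Finset.card_erase_of_mem (Finset.mem_univ _), Finset.card_univ, Fintype.card_fin] at h4
  have h5 : d ≤ (maximalIdeal A).spanFinrank := by exact_mod_cast h1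
  have := i.pos
  omega

theorem QI_split {A : Type*} [CommRing A] {d : ℕ} (x : Fin d → A) (S : Finset (Fin d))
    (a : Fin d → ℕ) (j : Fin d) (hj : j ∈ S) :
    QI x S a = Ideal.span {x j ^ a j} ⊔ QI x (S.erase j) a := by
  classical
  rw [QI, QI, ← Ideal.span_union]
  congr 1
  conv_lhs => rw [← Finset.insert_erase hj]
  rw [Finset.coe_insert, Set.image_insert_eq, Set.insert_eq]

theorem QI_congr {A : Type*} [CommRing A] {d : ℕ} (x : Fin d → A) (S : Finset (Fin d))
    (a b : Fin d → ℕ) (h : ∀ j ∈ S, a j = b j) : QI x S a = QI x S b := by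
  unfold QI
  congr 1
  apply Set.image_congr
  intro j hj
  simp only [h j hj]

theorem aux_nzd {A : Type*} [CommRing A] {d : ℕ} (x : Fin d → A)
    (hb : ∀ (S : Finset (Fin d)) (i : Fin d), i ∉ S → ∀ r : A,
      x i * r ∈ Ideal.span (x '' (S : Set (Fin d))) → r ∈ Ideal.span (x '' (S : Set (Fin d))))
    (N : ℕ) : ∀ (S : Finset (Fin d)) (a : Fin d → ℕ) (i : Fin d), ∑ j ∈ S, a j = N → i ∉ S →
      ∀ r : A, x i * r ∈ QI x S a → r ∈ QI x S a := by
  classical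
  induction N using Nat.strong_induction_on with
  | _ N ih =>
  intro S a i hN hi r hr
  by_cases h0 : ∃ j ∈ S, a j = 0
  · obtain ⟨j, hj, h⟩ := h0
    rw [QI_split x S a j hj, h, pow_zero, Ideal.span_singleton_one, top_sup_eq]
    trivial
  by_cases h2 : ∃ j ∈ S, 2 ≤ a j
  · obtain ⟨j, hj, hj2⟩ := h2
    have hsum := Finset.add_sum_erase S a hj
    have key : ∀ k, k < a j → ∀ r, x i * r ∈ Ideal.span {x j ^ k} ⊔ QI x (S.erase j) a →
        r ∈ Ideal.span {x j ^ k} ⊔ QI x (S.erase j) a := by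
      intro k hk r hr
      have e : Ideal.span {x j ^ k} ⊔ QI x (S.erase j) a = QI x S (Function.update a j k) := by
        rw [QI_split x S _ j hj, Function.update_self]
        congr 1
        apply QI_congr
        intro l hl
        rw [Function.update_of_ne (Finset.ne_of_mem_erase hl)]
      rw [e] at hr ⊢
      refine ih (∑ l ∈ S, Function.update a j k l) ?_ S _ i rfl hi r hr
      rw [← Finset.add_sum_erase S _ hj, Function.update_self, ← hN, ← hsum]
      have : ∑ l ∈ S.erase j, Function.update a j k l = ∑ l ∈ S.erase j, a l :=
        Finset.sum_congr rfl fun l hl => by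
          rw [Function.update_of_ne (Finset.ne_of_mem_erase hl)]
      omega
    have keyj : ∀ r, x j * r ∈ QI x (S.erase j) a → r ∈ QI x (S.erase j) a :=
      ih (∑ l ∈ S.erase j, a l) (by omega) _ a j rfl (Finset.notMem_erase _ _)
    have keyjp : ∀ (m : ℕ) (r : A), x j ^ m * r ∈ QI x (S.erase j) a → r ∈ QI x (S.erase j) a := by
      intro m
      induction m with
      | zero => intro r hr; simpa using hr
      | succ m ihm =>
        intro r hr
        exact ihm r (keyj _ (by rwa [← mul_assoc, ← pow_succ']))
    obtain ⟨m, hm⟩ : ∃ m, a j = m + 1 := ⟨a j - 1, by omega⟩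
    rw [QI_split x S a j hj] at hr ⊢
    have h1 : r ∈ Ideal.span {x j ^ m} ⊔ QI x (S.erase j) a := by
      refine key m (by omega) r ?_
      have hle : Ideal.span {x j ^ a j} ≤ Ideal.span {x j ^ m} := by
        rw [Ideal.span_singleton_le_span_singleton]
        exact pow_dvd_pow _ (by omega)
      exact (sup_le_sup_right hle (QI x (S.erase j) a)) hr
    obtain ⟨g, o, ho, rfl⟩ := Ideal.mem_span_singleton_sup.1 h1
    obtain ⟨h, o', ho', hh⟩ := Ideal.mem_span_singleton_sup.1 hr
    have h3 : x i * g - x j * h ∈ QI x (S.erase j) a := by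
      apply keyjp m
      have : x j ^ m * (x i * g - x j * h) = o' - x i * o := by
        rw [hm, pow_succ] at hh
        linear_combination -hh
      rw [this]
      exact Ideal.sub_mem _ ho' (Ideal.mul_mem_left _ _ ho)
    have h4 : g ∈ Ideal.span {x j ^ 1} ⊔ QI x (S.erase j) a := by
      apply key 1 (by omega)
      exact Ideal.mem_span_singleton_sup.2 ⟨h, _, h3, by ring⟩
    obtain ⟨g', o'', ho'', rfl⟩ := Ideal.mem_span_singleton_sup.1 h4
    refine Ideal.mem_span_singleton_sup.2 ⟨g', o'' * x j ^ m + o,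
      Ideal.add_mem _ (Ideal.mul_mem_right _ _ ho'') ho, ?_⟩
    rw [hm]; ring
  · push Not at h0 h2
    have : QI x S a = Ideal.span (x '' (S : Set (Fin d))) := by
      unfold QI
      congr 1
      apply Set.image_congr
      intro j hj
      have h1 := h0 j hj
      have h2 := h2 j hj
      have : a j = 1 := by omega
      simp [this]
    rw [this] at hr ⊢
    exact hb S i hi r hr

/-- the nonzerodivisor property of monomial ideals in a system of parameters -/
def NZ {A : Type*} [CommRing A] {d : ℕ} (x : Fin d → A) : Prop :=
  ∀ (S : Finset (Fin d)) (a : Fin d → ℕ) (i : Fin d), i ∉ S →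
      ∀ r : A, x i * r ∈ QI x S a → r ∈ QI x S a

theorem aux_alpha1 {A : Type*} [CommRing A] {d : ℕ} (x : Fin d → A) (h : NZ x)
    (c c' : Fin d → ℕ) (j : Fin d) (s : ℕ) (hc : c j = c' j + s) (hcc : ∀ k, k ≠ j → c k = c' k)
    (r : A) (hr : x j ^ s * r ∈ QI x Finset.univ c) : r ∈ QI x Finset.univ c' := by
  classical
  have keyjp : ∀ (m : ℕ) (r : A), x j ^ m * r ∈ QI x (Finset.univ.erase j) c' →
      r ∈ QI x (Finset.univ.erase j) c' := by
    intro m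
    induction m with
    | zero => intro r hr; simpa using hr
    | succ m ihm =>
      intro r hr
      exact ihm r (h _ _ _ (Finset.notMem_erase _ _) _ (by rwa [← mul_assoc, ← pow_succ']))
  rw [QI_split x _ _ j (Finset.mem_univ _)] at hr ⊢
  rw [QI_congr x (Finset.univ.erase j) c c' (fun k hk => hcc k (Finset.ne_of_mem_erase hk)), hc] at hr
  obtain ⟨g, o, ho, hh⟩ := Ideal.mem_span_singleton_sup.1 hr
  refine Ideal.mem_span_singleton_sup.2 ⟨g, r - g * x j ^ c' j, ?_, by ring⟩
  apply keyjp s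
  have : x j ^ s * (r - g * x j ^ c' j) = o := by
    rw [pow_add] at hh
    linear_combination -hh
  rwa [this]

theorem aux_alpha {A : Type*} [CommRing A] {d : ℕ} (x : Fin d → A) (h : NZ x)
    (s : Fin d → ℕ) (U : Finset (Fin d)) : ∀ (a c : Fin d → ℕ)
    (_ : ∀ j ∈ U, c j = a j + s j) (_ : ∀ j, j ∉ U → c j = a j) (r : A),
    (∏ j ∈ U, x j ^ s j) * r ∈ QI x Finset.univ c → r ∈ QI x Finset.univ a := by
  classical
  induction U using Finset.induction_on with
  | empty =>
    intro a c _ h2 r hr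
    rw [QI_congr x _ a c (fun j _ => (h2 j (by simp)).symm)]
    simpa using hr
  | insert j U hj ih =>
    intro a c h1 h2 r hr
    rw [Finset.prod_insert hj, mul_assoc] at hr
    refine ih a (Function.update c j (a j)) ?_ ?_ r
      (aux_alpha1 x h c _ j (s j) ?_ ?_ _ hr)
    · intro k hk
      rw [Function.update_of_ne (by rintro rfl; exact hj hk)]
      exact h1 k (Finset.mem_insert_of_mem hk)
    · intro k hk
      by_cases e : k = j
      · subst e; simp
      · rw [Function.update_of_ne e]
        exact h2 k (by simp [e, hk])
    · rw [Function.update_self]; exact h1 j (Finset.mem_insert_self _ _)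
    · intro k hk
      rw [Function.update_of_ne hk]

theorem aux_socle {A : Type*} [CommRing A] {d : ℕ} (x : Fin d → A) (h : NZ x) (N : ℕ)
    (r : A) (hr : ∀ j, x j * r ∈ QI x Finset.univ (fun _ => N + 1)) :
    r ∈ QI x Finset.univ (fun _ => N + 1) ⊔ Ideal.span {∏ j, x j ^ N} := by
  classical
  suffices H : ∀ U : Finset (Fin d),
      r ∈ QI x Finset.univ (fun _ => N + 1) ⊔ Ideal.span {∏ j ∈ U, x j ^ N} from H _
  intro U
  induction U using Finset.induction_on with
  | empty => simp
  | insert j U hj ih =>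
    rw [sup_comm] at ih
    obtain ⟨g, q, hq, rfl⟩ := Ideal.mem_span_singleton_sup.1 ih
    have h1 : (∏ k ∈ U, x k ^ N) * (x j * g) ∈ QI x Finset.univ (fun _ => N + 1) := by
      have := Ideal.sub_mem _ (hr j) (Ideal.mul_mem_left _ (x j) hq)
      convert this using 1
      ring
    have h2 := aux_alpha x h (fun _ => N) U (fun k => if k ∈ U then 1 else N + 1) _
      (by intro k hk; simp [hk, add_comm]) (by intro k hk; simp [hk]) _ h1
    have h3 : g ∈ QI x Finset.univ (fun k => if k ∈ U then 1 else if k = j then N else N + 1) := by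
      refine aux_alpha1 x h _ _ j 1 ?_ ?_ g (by rw [pow_one]; exact h2)
      · simp [hj]
      · intro k hk; simp [hk]
    apply Ideal.add_mem _ _ (Ideal.mem_sup_left hq)
    clear h1 h2 hq ih hr
    unfold QI at h3
    induction h3 using Submodule.span_induction with
    | mem y hy =>
      obtain ⟨k, -, rfl⟩ := hy
      by_cases hk : k ∈ U
      · apply Ideal.mem_sup_left
        have : x k ^ (N + 1) ∈ QI x Finset.univ (fun _ => N + 1) :=
          Ideal.subset_span ⟨k, by simp, rfl⟩
        rw [← Finset.mul_prod_erase _ _ hk]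
        simp only [hk, if_true]
        have e : x k ^ 1 * (x k ^ N * ∏ l ∈ U.erase k, x l ^ N) =
          (∏ l ∈ U.erase k, x l ^ N) * x k ^ (N + 1) := by ring
        rw [e]
        exact Ideal.mul_mem_left _ _ this
      · by_cases hkj : k = j
        · subst hkj
          apply Ideal.mem_sup_right
          rw [Finset.prod_insert hj]
          simp only [hj, if_false, if_true]
          exact Ideal.mem_span_singleton_self _
        · apply Ideal.mem_sup_left
          simp only [hk, hkj, if_false]
          exact Ideal.mul_mem_right _ _ (Ideal.subset_span ⟨k, by simp, rfl⟩)
    | zero => simp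
    | add y z _ _ hy hz => rw [add_mul]; exact Ideal.add_mem _ hy hz
    | smul b y _ hy => rw [smul_eq_mul, mul_assoc]; exact Ideal.mul_mem_left _ _ hy

open IsLocalRing in
theorem aux_len_soc {A : Type*} [CommRing A] [IsLocalRing A] (σ : A)
    (hσ : ∀ t ∈ maximalIdeal A, t * σ = 0) : Module.length A (Ideal.span {σ}) ≤ 1 := by
  have hle : maximalIdeal A ≤ LinearMap.ker (LinearMap.toSpanSingleton A A σ) := by
    intro t ht
    simpa using hσ t ht
  have h1 : Module.length A (A ⧸ maximalIdeal A) = 1 := by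
    rw [Module.length_eq_one_iff, isSimpleModule_iff_isCoatom]
    exact (maximalIdeal.isMaximal A).out
  rw [← h1]
  have hr : LinearMap.range ((maximalIdeal A).liftQ (LinearMap.toSpanSingleton A A σ) hle) =
      Ideal.span {σ} := by
    rw [Submodule.range_liftQ, LinearMap.range_toSpanSingleton]
  rw [← hr]
  exact Module.length_le_of_surjective _ (LinearMap.surjective_rangeRestrict _)

open IsLocalRing in
theorem aux_step {A : Type*} [CommRing A] [IsLocalRing A] [IsArtinianRing A] (σ : A)
    (hσ : ∀ t ∈ maximalIdeal A, t * σ = 0)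
    (hs : ∀ a : A, (∀ t ∈ maximalIdeal A, t * a = 0) → a ∈ Ideal.span {σ})
    (I I' : Ideal A) (h : I ⋖ I') :
    Module.length A I.annihilator + Module.length A I ≤
      Module.length A I'.annihilator + Module.length A I' := by
  obtain ⟨u, huI', huI⟩ := SetLike.exists_of_lt h.lt
  have hI' : I' = I ⊔ Ideal.span {u} := by
    have h1 : I < I ⊔ Ideal.span {u} := by
      refine lt_of_le_of_ne le_sup_left fun e => huI ?_
      rw [e]; exact Ideal.mem_sup_right (Ideal.mem_span_singleton_self u)
    have h2 : I ⊔ Ideal.span {u} ≤ I' :=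
      sup_le h.le ((Ideal.span_singleton_le_iff_mem _).2 huI')
    exact ((h.eq_or_eq h1.le h2).resolve_left h1.ne').symm
  have hmu : ∀ t ∈ maximalIdeal A, t * u ∈ I := by
    intro t ht
    by_contra hcon
    have h1 : I < I ⊔ Ideal.span {t * u} := by
      refine lt_of_le_of_ne le_sup_left fun e => hcon ?_
      rw [e]; exact Ideal.mem_sup_right (Ideal.mem_span_singleton_self _)
    have h2 : I ⊔ Ideal.span {t * u} ≤ I' :=
      sup_le h.le ((Ideal.span_singleton_le_iff_mem _).2 (Ideal.mul_mem_left _ _ huI'))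
    have h3 := (h.eq_or_eq h1.le h2).resolve_left h1.ne'
    rw [← h3, sup_comm] at huI'
    obtain ⟨g, o, ho, hg⟩ := Ideal.mem_span_singleton_sup.1 huI'
    have hunit : IsUnit (1 - g * t) := by
      by_contra hn
      have h4 : (1 - g * t) ∈ maximalIdeal A := hn
      have h5 := Ideal.add_mem _ h4 (Ideal.mul_mem_left _ g ht)
      rw [sub_add_cancel] at h5
      exact (Ideal.ne_top_iff_one _).1 (maximalIdeal.isMaximal A).ne_top h5
    obtain ⟨v, hv⟩ := hunit.exists_left_inv
    apply huI
    have : u = v * o := by linear_combination (-u) * hv - v * hg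
    rw [this]
    exact Ideal.mul_mem_left _ _ ho
  let φ : I.annihilator →ₗ[A] A := (LinearMap.mulRight A u).domRestrict I.annihilator
  have hφ : ∀ g, φ g = (g : A) * u := fun g => rfl
  have e1 : Module.length A I.annihilator =
      Module.length A (LinearMap.ker φ) + Module.length A (LinearMap.range φ) :=
    Module.length_eq_add_of_exact (LinearMap.ker φ).subtype φ.rangeRestrict
      (Submodule.injective_subtype _) (LinearMap.surjective_rangeRestrict _)
      (by
        rw [LinearMap.exact_iff, LinearMap.ker_rangeRestrict, Submodule.range_subtype])
  have e2 : Module.length A (LinearMap.range φ) ≤ 1 := by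
    refine le_trans ?_ (aux_len_soc σ hσ)
    have hle : LinearMap.range φ ≤ Ideal.span {σ} := by
      rintro _ ⟨g, rfl⟩
      apply hs
      intro t ht
      rw [hφ]
      have := Submodule.mem_annihilator.1 g.2 _ (hmu t ht)
      rw [smul_eq_mul] at this
      linear_combination this
    exact Module.length_le_of_injective (Submodule.inclusion hle) (Submodule.inclusion_injective hle)
  have e3 : Module.length A (LinearMap.ker φ) ≤ Module.length A I'.annihilator := by
    have hmem : ∀ g : LinearMap.ker φ, (I.annihilator.subtype.comp (LinearMap.ker φ).subtype) g ∈ I'.annihilator := by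
      intro g
      rw [Submodule.mem_annihilator]
      intro n hn
      rw [hI', sup_comm] at hn
      obtain ⟨c, o, ho, rfl⟩ := Ideal.mem_span_singleton_sup.1 hn
      have h1 := Submodule.mem_annihilator.1 g.1.2 _ ho
      have h2 : (g.1 : A) * u = 0 := g.2
      rw [smul_eq_mul] at h1 ⊢
      simp only [LinearMap.comp_apply, Submodule.subtype_apply]
      linear_combination h1 + c * h2
    refine Module.length_le_of_injective (LinearMap.codRestrict _ _ hmem) ?_
    intro a b hab
    have := congrArg Subtype.val hab
    exact Subtype.ext (Subtype.ext this)
  have e4 : Module.length A I + 1 ≤ Module.length A I' := by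
    rw [Module.length_submodule, Module.length_submodule]
    exact Order.add_one_le_of_lt (Submodule.height_strictMono h.lt)
  calc _ ≤ Module.length A I'.annihilator + 1 + Module.length A I := by
        rw [e1]; gcongr
    _ = Module.length A I'.annihilator + (Module.length A I + 1) := by ring
    _ ≤ _ := by gcongr

open IsLocalRing in
theorem aux_dual {A : Type*} [CommRing A] [IsLocalRing A] [IsArtinianRing A] (σ : A)
    (hσ : ∀ t ∈ maximalIdeal A, t * σ = 0)
    (hs : ∀ a : A, (∀ t ∈ maximalIdeal A, t * a = 0) → a ∈ Ideal.span {σ})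
    (J : Ideal A) (y : A) (hy : y ∉ J) : ∃ f : A, (∀ j ∈ J, f * j = 0) ∧ f * y = σ := by
  let D : Ideal A → ℕ∞ := fun I => Module.length A I.annihilator + Module.length A I
  have hst : ∀ I I' : Ideal A, I ⋖ I' → D I ≤ D I' := aux_step σ hσ hs
  have htop : ∀ I, D I ≤ D ⊤ := by
    intro I
    induction I using WellFoundedGT.induction with
    | _ I ih =>
      by_cases h : I = ⊤
      · rw [h]
      · obtain ⟨I', h1, -⟩ := exists_covBy_le_of_lt (lt_top_iff_ne_top.2 h)
        exact (hst _ _ h1).trans (ih I' h1.lt)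
  have hbot : ∀ I, D ⊥ ≤ D I := by
    intro I
    induction I using WellFoundedLT.induction with
    | _ I ih =>
      by_cases h : I = ⊥
      · rw [h]
      · obtain ⟨I', -, h1⟩ := exists_le_covBy_of_lt (bot_lt_iff_ne_bot.2 h)
        exact (ih I' h1.lt).trans (hst _ _ h1)
  have hbt : D ⊤ = D ⊥ := by
    simp only [D]
    rw [Submodule.annihilator_bot]
    have : (⊤ : Ideal A).annihilator = ⊥ := by
      rw [eq_bot_iff]
      intro a ha
      simpa using Submodule.mem_annihilator.1 ha 1 trivial
    rw [this, add_comm]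
  have hconst : ∀ I I', D I = D I' := by
    have : ∀ I, D I = D ⊥ := fun I => le_antisymm ((htop I).trans hbt.le) (hbot I)
    intro I I'
    rw [this I, this I']
  -- find `f` killing `J` but not `y`
  obtain ⟨f, hfJ, hfy⟩ : ∃ f : A, (∀ j ∈ J, f * j = 0) ∧ f * y ≠ 0 := by
    by_contra hcon
    push Not at hcon
    have hlt : J < J ⊔ Ideal.span {y} := by
      refine lt_of_le_of_ne le_sup_left fun e => hy ?_
      rw [e]; exact Ideal.mem_sup_right (Ideal.mem_span_singleton_self _)
    have hann : J.annihilator = (J ⊔ Ideal.span {y}).annihilator := by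
      apply le_antisymm
      · intro f hf
        have hf' : ∀ j ∈ J, f * j = 0 := fun j hj => Submodule.mem_annihilator.1 hf j hj
        rw [Submodule.mem_annihilator]
        intro n hn
        rw [sup_comm] at hn
        obtain ⟨c, o, ho, rfl⟩ := Ideal.mem_span_singleton_sup.1 hn
        rw [smul_eq_mul]
        linear_combination c * hcon f hf' + hf' o ho
      · exact Submodule.annihilator_mono hlt.le
    have h1 := hconst J (J ⊔ Ideal.span {y})
    simp only [D] at h1
    rw [← hann] at h1
    have h2 := ENat.add_right_injective_of_ne_top (Module.length_ne_top (R := A) (M := J.annihilator)) h1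
    rw [Module.length_submodule, Module.length_submodule] at h2
    exact (Submodule.height_strictMono hlt).ne h2
  have hnil : ∃ k, ∀ s ∈ maximalIdeal A ^ k, s * (f * y) = 0 := by
    obtain ⟨k, hk⟩ := IsArtinianRing.isNilpotent_jacobson_bot (R := A)
    rw [IsLocalRing.jacobson_eq_maximalIdeal ⊥ bot_ne_top] at hk
    refine ⟨k, fun s hs => ?_⟩
    rw [hk] at hs
    have : s = 0 := hs
    rw [this, zero_mul]
  classical
  have hk := Nat.find_spec hnil
  have hkm := fun m => Nat.find_min hnil (m := m)
  generalize Nat.find hnil = k at hk hkm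
  cases k with
  | zero => exact absurd (by simpa using hk 1 (by simp)) hfy
  | succ k =>
    have := hkm k (Nat.lt_succ_self _)
    push Not at this
    obtain ⟨s, hsk, hsne⟩ := this
    have hmem := hs (s * (f * y)) (fun t ht => by
      rw [← mul_assoc]
      apply hk
      rw [pow_succ']
      exact Ideal.mul_mem_mul ht hsk)
    obtain ⟨c, hc⟩ := Ideal.mem_span_singleton'.1 hmem
    have hcu : IsUnit c := by
      by_contra hn
      exact hsne (by rw [← hc]; exact hσ c hn)
    obtain ⟨v, hv⟩ := hcu.exists_left_inv
    refine ⟨v * s * f, fun j hj => by rw [mul_assoc, hfJ j hj, mul_zero], ?_⟩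
    linear_combination (-v) * hc + σ * hv

theorem QI_pow {A : Type*} [CommRing A] {d : ℕ} (p : ℕ) [Fact p.Prime] [CharP A p]
    (x : Fin d → A) (S : Finset (Fin d)) (a : Fin d → ℕ) (e : ℕ) (z : A) (hz : z ∈ QI x S a) :
    z ^ p ^ e ∈ QI x S (fun j => p ^ e * a j) := by
  unfold QI at hz
  induction hz using Submodule.span_induction with
  | mem y hy =>
    obtain ⟨k, hk, rfl⟩ := hy
    refine Ideal.subset_span ⟨k, hk, ?_⟩
    simp only
    rw [← pow_mul, mul_comm]
  | zero =>
    rw [zero_pow (pow_ne_zero _ (Fact.out : p.Prime).ne_zero)]; exact Ideal.zero_mem _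
  | add y z _ _ hy hz => rw [add_pow_char_pow]; exact Ideal.add_mem _ hy hz
  | smul b y _ hy => rw [smul_eq_mul, mul_pow]; exact Ideal.mul_mem_left _ _ hy

theorem QI_le_pow {A : Type*} [CommRing A] [IsLocalRing A] {d : ℕ} (x : Fin d → A)
    (hx : Ideal.span (Set.range x) = IsLocalRing.maximalIdeal A) (N : ℕ) :
    QI x Finset.univ (fun _ => N) ≤ IsLocalRing.maximalIdeal A ^ N := by
  unfold QI
  rw [Ideal.span_le]
  rintro _ ⟨j, -, rfl⟩
  exact Ideal.pow_mem_pow (hx ▸ Ideal.subset_span ⟨j, rfl⟩) _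

open IsLocalRing in
theorem aux_flat {A : Type u} [CommRing A] [IsLocalRing A] [IsNoetherianRing A] {d : ℕ}
    (p : ℕ) [Fact p.Prime] [CharP A p] (x : Fin d → A)
    (hx : Ideal.span (Set.range x) = maximalIdeal A) (h : NZ x)
    (J : Ideal A) (y : A) (hy : y ∉ J) (e : ℕ) (r : A) (hr : r * y ^ p ^ e ∈ frobPow A J (p ^ e)) :
    r ∈ QI x Finset.univ (fun _ => p ^ e) := by
  classical
  obtain ⟨N, hN⟩ : ∃ N, y ∉ J ⊔ QI x Finset.univ (fun _ => N + 1) := by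
    by_contra hcon
    push Not at hcon
    have hmem : (Ideal.Quotient.mk J y) ∈
        (⨅ i : ℕ, maximalIdeal A ^ i • ⊤ : Submodule A (A ⧸ J)) := by
      rw [Submodule.mem_iInf]
      intro N
      obtain ⟨j, hj, t, ht, hjt⟩ := Submodule.mem_sup.1 (hcon N)
      have ht' : t ∈ maximalIdeal A ^ N := Ideal.pow_le_pow_right (Nat.le_succ N) (QI_le_pow x hx _ ht)
      have : Ideal.Quotient.mk J y = t • (1 : A ⧸ J) := by
        rw [← hjt, map_add, Ideal.Quotient.eq_zero_iff_mem.2 hj, zero_add, Algebra.smul_def, mul_one]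
        rfl
      rw [this]
      exact Submodule.smul_mem_smul ht' trivial
    rw [Ideal.iInf_pow_smul_eq_bot_of_isLocalRing _ (maximalIdeal.isMaximal A).ne_top,
      Submodule.mem_bot, Ideal.Quotient.eq_zero_iff_mem] at hmem
    exact hy hmem
  generalize hQ : QI x Finset.univ (fun _ => N + 1) = Q at hN
  have hQm : Q ≤ maximalIdeal A := by
    rw [← hQ]
    exact (QI_le_pow x hx _).trans (Ideal.pow_le_self (Nat.succ_ne_zero N))
  have hloc := aux_quot_local Q hQm
  have hmax := aux_maxIdeal_quot Q hQm
  have hgen : maximalIdeal (A ⧸ Q) = Ideal.span (Ideal.Quotient.mk Q '' Set.range x) := by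
    rw [← hmax, ← hx, Ideal.map_span]
  have hart : IsArtinianRing (A ⧸ Q) := by
    rw [isArtinianRing_iff_isNilpotent_maximalIdeal,
      Ideal.FG.isNilpotent_iff_le_nilradical (IsNoetherian.noetherian _), hgen, Ideal.span_le]
    rintro _ ⟨_, ⟨j, rfl⟩, rfl⟩
    refine ⟨N + 1, ?_⟩
    rw [← map_pow]
    refine Ideal.Quotient.eq_zero_iff_mem.2 ?_
    rw [← hQ]
    exact Ideal.subset_span ⟨j, by simp, rfl⟩
  obtain ⟨fb, hf1, hf2⟩ := aux_dual (A := A ⧸ Q) (Ideal.Quotient.mk Q (∏ j, x j ^ N))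
    (by
      intro t ht
      rw [hgen] at ht
      induction ht using Submodule.span_induction with
      | mem t ht =>
        obtain ⟨_, ⟨k, rfl⟩, rfl⟩ := ht
        rw [← map_mul, Ideal.Quotient.eq_zero_iff_mem, ← hQ,
          ← Finset.mul_prod_erase _ _ (Finset.mem_univ k), ← mul_assoc, ← pow_succ']
        exact Ideal.mul_mem_right _ _ (Ideal.subset_span ⟨k, by simp, rfl⟩)
      | zero => simp
      | add y z _ _ hy hz => rw [add_mul, hy, hz, add_zero]
      | smul b y _ hy => rw [smul_eq_mul, mul_assoc, hy, mul_zero])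
    (by
      intro a ha
      obtain ⟨a, rfl⟩ := Ideal.Quotient.mk_surjective a
      have h1 : ∀ j, x j * a ∈ QI x Finset.univ (fun _ => N + 1) := by
        intro j
        rw [hQ, ← Ideal.Quotient.eq_zero_iff_mem, map_mul]
        apply ha
        rw [hgen]
        exact Ideal.subset_span ⟨x j, ⟨j, rfl⟩, rfl⟩
      have h2 := aux_socle x h N a h1
      rw [sup_comm, hQ] at h2
      obtain ⟨c, o, ho, rfl⟩ := Ideal.mem_span_singleton_sup.1 h2
      rw [map_add, Ideal.Quotient.eq_zero_iff_mem.2 ho, add_zero, map_mul]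
      exact Ideal.mul_mem_left _ _ (Ideal.mem_span_singleton_self _))
    (J.map (Ideal.Quotient.mk Q)) (Ideal.Quotient.mk Q y)
    (by
      rw [← Ideal.mem_comap, Ideal.comap_map_of_surjective _ Ideal.Quotient.mk_surjective,
        ← RingHom.ker_eq_comap_bot, Ideal.mk_ker]
      exact hN)
  obtain ⟨f, rfl⟩ := Ideal.Quotient.mk_surjective fb
  have hfJ : ∀ j ∈ J, f * j ∈ Q := fun j hj => by
    rw [← Ideal.Quotient.eq_zero_iff_mem, map_mul]
    exact hf1 _ (Ideal.mem_map_of_mem _ hj)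
  have hfy : f * y - ∏ j, x j ^ N ∈ Q := by
    rw [← Ideal.Quotient.eq, map_mul]; exact hf2
  subst hQ
  have hmem : f ^ p ^ e * (r * y ^ p ^ e) ∈ QI x Finset.univ (fun _ => p ^ e * (N + 1)) := by
    unfold frobPow at hr
    generalize r * y ^ p ^ e = v at hr ⊢
    induction hr using Submodule.span_induction with
    | mem z hz =>
      obtain ⟨j, hj, rfl⟩ := hz
      simp only
      rw [← mul_pow]
      exact QI_pow p x _ _ e _ (hfJ j hj)
    | zero => simp
    | add y z _ _ hy hz => rw [mul_add (f ^ p ^ e) y z]; exact Ideal.add_mem _ hy hz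
    | smul b y _ hy => rw [smul_eq_mul, mul_left_comm]; exact Ideal.mul_mem_left _ _ hy
  have hmem2 := QI_pow p x _ _ e _ hfy
  rw [sub_pow_char_pow] at hmem2
  have hmem3 : (∏ j, x j ^ (p ^ e * N)) * r ∈ QI x Finset.univ (fun _ => p ^ e * (N + 1)) := by
    have := Ideal.sub_mem _ hmem (Ideal.mul_mem_left _ r hmem2)
    convert this using 1
    have e1 : (∏ j, x j ^ (p ^ e * N)) = (∏ j, x j ^ N) ^ p ^ e := by
      rw [← Finset.prod_pow]
      refine Finset.prod_congr rfl fun j _ => ?_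
      rw [← pow_mul, mul_comm]
    rw [e1]; ring
  exact aux_alpha x h (fun _ => p ^ e * N) Finset.univ _ _ (by intro j _; ring) (by simp) r hmem3

open IsLocalRing in
theorem aux_lower {A : Type u} [CommRing A] [IsLocalRing A] [IsNoetherianRing A] {d : ℕ}
    (p : ℕ) [Fact p.Prime] [CharP A p] (x : Fin d → A)
    (hx : Ideal.span (Set.range x) = maximalIdeal A) (h : NZ x) (n k : ℕ) (hk : n + 1 ≤ k + d) :
    maximalIdeal A ^ k ≤ testIdeal A p (maximalIdeal A) (n : ℚ) := by
  intro w hw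
  unfold testIdeal
  rw [Submodule.mem_iInf]
  intro J
  rw [Submodule.mem_colon]
  intro z hz
  rw [SetLike.mem_coe] at hz
  rw [smul_eq_mul]
  induction hz using Submodule.span_induction with
  | zero => simp
  | add y z _ _ hy hz => rw [mul_add]; exact Ideal.add_mem _ hy hz
  | smul b y _ hy => rw [smul_eq_mul, mul_left_comm]; exact Ideal.mul_mem_left _ _ hy
  | mem z hz =>
  obtain ⟨c, hc, e₀, hz⟩ := hz
  by_contra hwz
  have hc0 : c ∈ (⨅ i : ℕ, maximalIdeal A ^ i : Ideal A) := by
    rw [Submodule.mem_iInf]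
    intro b
    have hp1 : 1 < p := (Fact.out : p.Prime).one_lt
    obtain ⟨e, he0, hq⟩ : ∃ e, e₀ ≤ e ∧ (d + 1) * (1 + b) ≤ p ^ e := by
      refine ⟨max e₀ ((d + 1) * (1 + b)), le_max_left _ _, ?_⟩
      exact (le_max_right _ _).trans (Nat.lt_pow_self hp1).le
    have hceil : ⌈(n : ℚ) * (p : ℚ) ^ e⌉₊ = n * p ^ e := by
      rw [← Nat.cast_pow, ← Nat.cast_mul, Nat.ceil_natCast]
    have h1 := hz e he0
    rw [hceil] at h1
    have hb : b + 1 ≤ p ^ e := by nlinarith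
    obtain ⟨s, hs⟩ := Nat.exists_eq_add_of_le hb
    have hxm : ∀ j, x j ∈ maximalIdeal A := fun j => hx ▸ Ideal.subset_span ⟨j, rfl⟩
    have hmem : w ^ p ^ e * ∏ j, x j ^ s ∈ maximalIdeal A ^ (n * p ^ e) := by
      have h2 : ∏ j, x j ^ s ∈ maximalIdeal A ^ (∑ _j : Fin d, s) := by
        rw [← Finset.prod_pow_eq_pow_sum]
        exact Ideal.prod_mem_prod fun j _ => Ideal.pow_mem_pow (hxm j) _
      have h3 := Ideal.pow_mem_pow hw (p ^ e)
      rw [← pow_mul] at h3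
      have h4 := Ideal.mul_mem_mul h3 h2
      rw [← pow_add] at h4
      refine Ideal.pow_le_pow_right ?_ h4
      simp only [Finset.sum_const, Finset.card_univ, Fintype.card_fin, smul_eq_mul]
      have h5 := Nat.mul_le_mul_right (p ^ e) hk
      have h6 : d * p ^ e = d * (b + 1) + d * s := by rw [hs]; ring
      nlinarith
    have h7 := h1 _ hmem
    have h8 : (∏ j, x j ^ s) * c ∈ QI x Finset.univ (fun _ => p ^ e) := by
      refine aux_flat p x hx h J (w * z) hwz e _ ?_
      convert h7 using 1
      rw [mul_pow]; ring
    have h9 := aux_alpha x h (fun _ => s) Finset.univ (fun _ => b + 1) _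
      (by intro j _; exact hs) (by simp) c h8
    exact Ideal.pow_le_pow_right (Nat.le_succ b) (QI_le_pow x hx _ h9)
  rw [Ideal.iInf_pow_eq_bot_of_isLocalRing _ (maximalIdeal.isMaximal A).ne_top] at hc0
  have hc0' : c = 0 := hc0
  obtain ⟨P, hP, _⟩ := Ideal.exists_minimalPrimes_le (I := (⊥ : Ideal A)) (J := maximalIdeal A) bot_le
  exact hc P hP (hc0' ▸ P.zero_mem)

theorem aux_monomials {A : Type*} [CommRing A] {d : ℕ} (x : Fin d → A) (M : ℕ) :
    Ideal.span (Set.range x) ^ M ≤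
      Ideal.span {y | ∃ a : Fin d → ℕ, ∑ j, a j = M ∧ y = ∏ j, x j ^ a j} := by
  classical
  induction M with
  | zero =>
    rw [pow_zero, Ideal.one_eq_top, top_le_iff, Ideal.eq_top_iff_one]
    exact Ideal.subset_span ⟨0, by simp, by simp⟩
  | succ M ih =>
    rw [pow_succ]
    refine (Ideal.mul_mono_left ih).trans ?_
    rw [Ideal.span_mul_span', Ideal.span_le]
    rintro _ ⟨_, ⟨a, ha, rfl⟩, _, ⟨i, rfl⟩, rfl⟩
    refine Ideal.subset_span ⟨a + Pi.single i 1, ?_, ?_⟩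
    · simp [Finset.sum_add_distrib, ha]
    · simp only [Pi.add_apply, pow_add, Finset.prod_mul_distrib]
      congr 1
      rw [Finset.prod_eq_single i]
      · simp
      · intro j _ hj; simp [hj]
      · simp

open IsLocalRing in
theorem aux_upper {A : Type u} [CommRing A] [IsLocalRing A] {d : ℕ}
    (p : ℕ) [Fact p.Prime] (x : Fin d → A)
    (hx : Ideal.span (Set.range x) = maximalIdeal A) (n : ℕ) (hn : 1 ≤ n) (hdn : d ≤ n) :
    testIdeal A p (maximalIdeal A) (n : ℚ) ≤ maximalIdeal A ^ (n - d + 1) := by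
  intro w hw
  unfold testIdeal at hw
  rw [Submodule.mem_iInf] at hw
  have h1 := hw (maximalIdeal A ^ (n - d + 1))
  rw [Submodule.mem_colon] at h1
  have h2 := h1 1 (Ideal.subset_span ?_)
  · simpa using h2
  refine ⟨1, fun P hP => (Ideal.ne_top_iff_one _).1 hP.1.1.ne_top, 0, fun e _ y hy => ?_⟩
  have hceil : ⌈(n : ℚ) * (p : ℚ) ^ e⌉₊ = n * p ^ e := by
    rw [← Nat.cast_pow, ← Nat.cast_mul, Nat.ceil_natCast]
  rw [hceil] at hy
  rw [one_pow, one_mul, one_mul]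
  have hq : 0 < p ^ e := pow_pos (Fact.out : p.Prime).pos e
  generalize p ^ e = q at *
  have hxm : ∀ j, x j ∈ maximalIdeal A := fun j => hx ▸ Ideal.subset_span ⟨j, rfl⟩
  rw [← hx] at hy
  have hy2 := aux_monomials x _ hy
  clear hy
  refine (Ideal.span_le.2 ?_) hy2
  rintro _ ⟨a, ha, rfl⟩
  have e1 : ∏ j, x j ^ a j = (∏ j, x j ^ (a j % q)) * (∏ j, x j ^ (a j / q)) ^ q := by
    rw [← Finset.prod_pow, ← Finset.prod_mul_distrib]
    refine Finset.prod_congr rfl fun j _ => ?_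
    rw [← pow_mul, ← pow_add, mul_comm (a j / q), Nat.mod_add_div]
  rw [e1]
  refine Ideal.mul_mem_left _ _ (Ideal.subset_span ⟨_, ?_, rfl⟩)
  have hmem : ∏ j, x j ^ (a j / q) ∈ maximalIdeal A ^ (∑ j, a j / q) := by
    rw [← Finset.prod_pow_eq_pow_sum]
    exact Ideal.prod_mem_prod fun j _ => Ideal.pow_mem_pow (hxm j) _
  refine Ideal.pow_le_pow_right ?_ hmem
  by_contra hlt
  have hle : ∑ j, a j / q ≤ n - d := by omega
  have hsum : ∑ j, a j ≤ ∑ j : Fin d, (q * (a j / q) + (q - 1)) := by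
    refine Finset.sum_le_sum fun j _ => ?_
    have := Nat.mod_add_div (a j) q
    have := Nat.mod_lt (a j) hq
    omega
  rw [Finset.sum_add_distrib, ← Finset.mul_sum, ha] at hsum
  simp only [Finset.sum_const, Finset.card_univ, Fintype.card_fin, smul_eq_mul] at hsum
  rcases Nat.eq_zero_or_pos d with hd | hd
  · subst hd
    simp only [Finset.univ_eq_empty, Finset.sum_empty] at ha
    have := Nat.mul_pos hn hq
    omega
  · obtain ⟨m, rfl⟩ := Nat.exists_eq_add_of_le hdn
    obtain ⟨t, rfl⟩ := Nat.exists_eq_add_of_le' hq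
    simp only [Nat.add_sub_cancel_left, Nat.add_sub_cancel] at hle hsum
    nlinarith

/-- **Example 4.5** (Hara–Takagi, cf. [HY, Theorem 2.15]).  If `(R,m)` is a `d`-dimensional
F-finite regular local ring of characteristic `p > 0`, then `τ(mⁿ) = R` for `n < d` and
`τ(mⁿ) = m^{n-d+1}` for `n ≥ d` (for every `n ≥ 1`). -/
theorem testIdeal_pow_maximalIdeal_regular
    (p : ℕ) [Fact p.Prime] [CharP R p] [ExpChar R p]
    [IsLocalRing R] (hreg : IsRegularLocal R)
    (hFF : IsFFinite R p)
    (d : ℕ) (hd : ringKrullDim R = d) :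
    ∀ n : ℕ, 1 ≤ n →
      (n < d → testIdeal R p (IsLocalRing.maximalIdeal R) ((n : ℚ)) = ⊤) ∧
      (d ≤ n → testIdeal R p (IsLocalRing.maximalIdeal R) ((n : ℚ))
        = IsLocalRing.maximalIdeal R ^ (n - d + 1)) := by
  obtain ⟨hN, d', x, hx, hd'⟩ := hreg
  have hdd : d' = d := by
    rw [hd] at hd'
    exact_mod_cast hd'.symm
  subst hdd
  have hnz : NZ x := fun S a i hi r hr =>
    aux_nzd x (aux_base x hx hd) _ S a i rfl hi r hr
  intro n hn
  constructor
  · intro hlt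
    have h := aux_lower p x hx hnz n 0 (by omega)
    rw [pow_zero, Ideal.one_eq_top] at h
    exact top_le_iff.1 h
  · intro hle
    exact le_antisymm (aux_upper p x hx n hn hle) (aux_lower p x hx hnz n _ (by omega))
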